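/- There is a constant C such that for every f ∈ C_c^∞(ℝ⁵) supported in the ball of radius 2, the recovered field satisfies ‖K * f‖_{L^{10}(ℝ⁵)} ≤ C (‖f‖_{L²(ℝ⁵)} + ‖∇f‖_{L²(ℝ⁵)}). -/

import Mathlib

open MeasureTheory Metric

noncomputable section

/-- `ℝ⁵ = ℝ⁴ × ℝ` with the Euclidean norm; the last coordinate is `z`. -/
abbrev E5 := EuclideanSpace ℝ (Fin 5)

/-- The lifted recovery kernel `K(X) = −∂_zΦ₅(X) = 3z/(8π²|X|⁵)`, `z = X 4`. -/
def Kker (X : E5) : ℝ := 3 * X 4 / (8 * Real.pi ^ 2 * ‖X‖ ^ 5)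


/-- near part of the Riesz kernel -/
def kN (r : ℝ) (x : E5) : ENNReal :=
  ENNReal.ofReal (Set.indicator (Set.Iio r) (fun ρ : ℝ => (ρ ^ 4)⁻¹) ‖x‖)

/-- far part of the Riesz kernel -/
def kF (r : ℝ) (x : E5) : ENNReal :=
  ENNReal.ofReal (Set.indicator (Set.Ici r) (fun ρ : ℝ => (ρ ^ 4)⁻¹) ‖x‖)

lemma kN_meas (r : ℝ) : Measurable (kN r) := by
  unfold kN
  refine ENNReal.measurable_ofReal.comp (Measurable.comp (g := Set.indicator (Set.Iio r) (fun ρ : ℝ => (ρ ^ 4)⁻¹)) ?_ measurable_norm)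
  exact Measurable.indicator (by fun_prop) measurableSet_Iio

lemma kF_meas (r : ℝ) : Measurable (kF r) := by
  unfold kF
  refine ENNReal.measurable_ofReal.comp (Measurable.comp (g := Set.indicator (Set.Ici r) (fun ρ : ℝ => (ρ ^ 4)⁻¹)) ?_ measurable_norm)
  exact Measurable.indicator (by fun_prop) measurableSet_Ici

lemma k_split (r : ℝ) (x : E5) : ENNReal.ofReal ((‖x‖ ^ 4)⁻¹) = kN r x + kF r x := by
  unfold kN kF
  by_cases h : ‖x‖ < r
  · have h' : ¬ r ≤ ‖x‖ := not_le.2 h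
    simp [Set.indicator, h, h']
  · have h' : r ≤ ‖x‖ := not_lt.1 h
    simp [Set.indicator, h, h']

lemma volB_pos : 0 < (volume : Measure E5).real (ball 0 1) :=
  ENNReal.toReal_pos (measure_ball_pos _ _ one_pos).ne' measure_ball_lt_top.ne

lemma near_bound : ∃ B : ℝ, 0 < B ∧ ∀ r : ℝ, 0 < r → ∫⁻ x, kN r x = ENNReal.ofReal (B * r) := by
  refine ⟨5 * (volume : Measure E5).real (ball 0 1), by have := volB_pos; positivity, fun r hr => ?_⟩
  have key : Set.EqOn (fun y : ℝ => y ^ (Module.finrank ℝ E5 - 1) •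
      Set.indicator (Set.Iio r) (fun ρ : ℝ => (ρ ^ 4)⁻¹) y)
      (Set.indicator (Set.Iio r) (fun _ => (1:ℝ))) (Set.Ioi 0) := by
    intro y hy
    have hy : 0 < y := hy
    by_cases h : y < r
    · simp [Set.indicator, h, hy.ne']
    · simp [Set.indicator, h]
  have hI : Integrable (fun x : E5 => Set.indicator (Set.Iio r) (fun ρ : ℝ => (ρ ^ 4)⁻¹) ‖x‖) := by
    rw [integrable_fun_norm_addHaar (volume : Measure E5) (f := Set.indicator (Set.Iio r) (fun ρ : ℝ => (ρ ^ 4)⁻¹)),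
      integrableOn_congr_fun key measurableSet_Ioi, integrableOn_indicator_iff measurableSet_Iio]
    simp [Set.Iio_inter_Ioi]
  unfold kN
  rw [← ofReal_integral_eq_lintegral_ofReal hI]
  · rw [integral_fun_norm_addHaar (volume : Measure E5) (Set.indicator (Set.Iio r) (fun ρ : ℝ => (ρ ^ 4)⁻¹)),
      setIntegral_congr_fun measurableSet_Ioi key, setIntegral_indicator measurableSet_Iio]
    simp [Set.Ioi_inter_Iio, hr.le, mul_assoc]
  · refine Filter.Eventually.of_forall fun x => ?_
    exact Set.indicator_apply_nonneg (fun _ => by positivity)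

lemma far_bound : ∃ A : ℝ, 0 < A ∧ ∀ r : ℝ, 0 < r →
    ∫⁻ x, (kF r x) ^ ((10:ℝ)/7) = ENNReal.ofReal (A * r ^ (-(5:ℝ)/7)) := by
  refine ⟨5 * (volume : Measure E5).real (ball 0 1) * (7/5), by have := volB_pos; positivity, fun r hr => ?_⟩
  set φ : ℝ → ℝ := Set.indicator (Set.Ici r) (fun ρ : ℝ => ((ρ ^ 4)⁻¹) ^ ((10:ℝ)/7)) with hφ
  have key : Set.EqOn (fun y : ℝ => y ^ (Module.finrank ℝ E5 - 1) • φ y)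
      (Set.indicator (Set.Ici r) (fun y => y ^ (-(12:ℝ)/7))) (Set.Ioi 0) := by
    intro y hy
    have hy : 0 < y := hy
    by_cases h : r ≤ y
    · simp only [hφ, Set.indicator, Set.mem_Ici, h, if_true, finrank_euclideanSpace, Fintype.card_fin, smul_eq_mul]
      rw [← Real.rpow_natCast, ← Real.rpow_neg hy.le, ← Real.rpow_mul hy.le, ← Real.rpow_add hy]
      norm_num
    · simp [hφ, Set.indicator, h]
  have hsub : Set.Ioi (0:ℝ) ∩ Set.Ici r = Set.Ici r := by
    ext y; simp; intro h; linarith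
  have hI : Integrable (fun x : E5 => φ ‖x‖) := by
    rw [integrable_fun_norm_addHaar (volume : Measure E5) (f := φ),
      integrableOn_congr_fun key measurableSet_Ioi, integrableOn_indicator_iff measurableSet_Ici,
      Set.inter_comm, hsub, integrableOn_Ici_iff_integrableOn_Ioi]
    exact integrableOn_Ioi_rpow_of_lt (by norm_num) hr
  have e : ∀ x : E5, (kF r x) ^ ((10:ℝ)/7) = ENNReal.ofReal (φ ‖x‖) := by
    intro x
    unfold kF
    by_cases h : r ≤ ‖x‖
    · simp only [hφ, Set.indicator, Set.mem_Ici, h, if_true]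
      rw [ENNReal.ofReal_rpow_of_nonneg (by positivity) (by norm_num)]
    · simp [hφ, Set.indicator, h]
  simp_rw [e]
  rw [← ofReal_integral_eq_lintegral_ofReal hI]
  · rw [integral_fun_norm_addHaar (volume : Measure E5) φ,
      setIntegral_congr_fun measurableSet_Ioi key, setIntegral_indicator measurableSet_Ici, hsub,
      integral_Ici_eq_integral_Ioi, integral_Ioi_rpow_of_lt (by norm_num) hr]
    congr 1
    simp only [finrank_euclideanSpace, Fintype.card_fin, smul_eq_mul, nsmul_eq_mul]
    norm_num
    ring
  · refine Filter.Eventually.of_forall fun x => ?_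
    exact Set.indicator_apply_nonneg (fun _ => by positivity)

/-- the Riesz potential of order one -/
def Iop (G : E5 → ENNReal) (x : E5) : ENNReal := ∫⁻ y, ENNReal.ofReal ((‖x - y‖ ^ 4)⁻¹) * G y

lemma far_le : ∃ A : ℝ, 0 < A ∧ ∀ G : E5 → ENNReal, Measurable G → ∫⁻ y, G y ^ ((10:ℝ)/3) ≤ 1 →
    ∀ r : ℝ, 0 < r → ∀ x : E5, ∫⁻ y, kF r (x - y) * G y ≤ ENNReal.ofReal (A * r ^ (-(1:ℝ)/2)) := by
  obtain ⟨A, hA, h⟩ := far_bound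
  refine ⟨A ^ ((7:ℝ)/10), by positivity, fun G hG hG1 r hr x => ?_⟩
  have hpq : ((10:ℝ)/7).HolderConjugate (10/3) := by
    rw [Real.holderConjugate_iff]; norm_num
  have hm : AEMeasurable (fun y => kF r (x - y)) (volume : Measure E5) :=
    ((kF_meas r).comp (measurable_const.sub measurable_id)).aemeasurable
  have := ENNReal.lintegral_mul_le_Lp_mul_Lq (volume : Measure E5) hpq hm hG.aemeasurable
  refine this.trans ?_
  rw [lintegral_sub_left_eq_self (fun y => kF r y ^ ((10:ℝ)/7)) x, h r hr]
  calc _ ≤ (ENNReal.ofReal (A * r ^ (-(5:ℝ)/7))) ^ (1 / ((10:ℝ)/7)) * 1 := by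
        gcongr
        exact ENNReal.rpow_le_one hG1 (by norm_num)
    _ = _ := by
        rw [mul_one, ENNReal.ofReal_rpow_of_nonneg (by positivity) (by norm_num),
          Real.mul_rpow hA.le (by positivity), ← Real.rpow_mul hr.le]
        norm_num

lemma level_le : ∃ c D : ℝ, 0 < c ∧ 0 < D ∧ ∀ g : E5 → ℝ, Measurable g →
    ∫⁻ y, ENNReal.ofReal (g y) ^ ((10:ℝ)/3) ≤ 1 → ∀ t : ℝ, 0 < t →
    volume {x | ENNReal.ofReal t < Iop (fun y => ENNReal.ofReal (g y)) x} ≤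
      ENNReal.ofReal (D * (t ^ 3)⁻¹) *
        ∫⁻ y, Set.indicator {y | c * t ^ 3 < g y} (fun y => ENNReal.ofReal (g y)) y := by
  obtain ⟨A, hA, hfar⟩ := far_le
  obtain ⟨B, hB, hnear⟩ := near_bound
  refine ⟨(64 * A ^ 2 * B)⁻¹, 32 * A ^ 2 * B, by positivity, by positivity, fun g hg hg1 t ht => ?_⟩
  set r : ℝ := (4 * A / t) ^ 2 with hr
  have hr0 : 0 < r := by positivity
  set s : ℝ := (64 * A ^ 2 * B)⁻¹ * t ^ 3 with hs
  have hs0 : 0 < s := by positivity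
  have hG : Measurable (fun y => ENNReal.ofReal (g y)) := hg.ennreal_ofReal
  set H := Set.indicator {y | s < g y} (fun y => ENNReal.ofReal (g y)) with hH
  have hHm : Measurable H := hG.indicator (measurableSet_lt measurable_const hg)
  have hkm : Measurable (fun p : E5 × E5 => kN r (p.1 - p.2)) := (kN_meas r).comp (measurable_fst.sub measurable_snd)
  -- pointwise
  have hpt : ∀ x, Iop (fun y => ENNReal.ofReal (g y)) x ≤
      ENNReal.ofReal (t / 2) + ∫⁻ y, kN r (x - y) * H y := by
    intro x
    have hkx : Measurable (fun y => kN r (x - y)) := (kN_meas r).comp (measurable_const.sub measurable_id)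
    have hfx : Measurable (fun y => kF r (x - y)) := (kF_meas r).comp (measurable_const.sub measurable_id)
    calc Iop (fun y => ENNReal.ofReal (g y)) x
        ≤ ∫⁻ y, (kF r (x - y) * ENNReal.ofReal (g y) +
            (kN r (x - y) * ENNReal.ofReal s + kN r (x - y) * H y)) := by
          refine lintegral_mono fun y => ?_
          dsimp only
          rw [k_split r, add_mul, add_comm, ← mul_add]
          gcongr
          by_cases hy : s < g y
          · rw [hH, Set.indicator_of_mem (show y ∈ {y | s < g y} from hy)]
            exact le_add_self
          · exact le_add_right (ENNReal.ofReal_le_ofReal (not_lt.1 hy))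
      _ = (∫⁻ y, kF r (x - y) * ENNReal.ofReal (g y)) +
            ((∫⁻ y, kN r (x - y)) * ENNReal.ofReal s + ∫⁻ y, kN r (x - y) * H y) := by
          have e1 : Measurable (fun y => kF r (x - y) * ENNReal.ofReal (g y)) := hfx.mul hG
          have e2 : Measurable (fun y => kN r (x - y) * ENNReal.ofReal s) := hkx.mul_const _
          rw [lintegral_add_left e1, lintegral_add_left e2, lintegral_mul_const _ hkx]
      _ ≤ ENNReal.ofReal (t / 4) + (ENNReal.ofReal (t / 4) + ∫⁻ y, kN r (x - y) * H y) := by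
          gcongr
          · refine (hfar _ hG hg1 r hr0 x).trans (le_of_eq ?_)
            congr 1
            rw [hr, ← Real.rpow_natCast, ← Real.rpow_mul (by positivity)]
            norm_num
            rw [Real.rpow_neg_one]
            field_simp
          · rw [lintegral_sub_left_eq_self (fun y => kN r y) x, hnear r hr0,
              ← ENNReal.ofReal_mul (by positivity)]
            refine ENNReal.ofReal_le_ofReal (le_of_eq ?_)
            rw [hr, hs]
            field_simp
            norm_num
      _ = _ := by
          rw [← add_assoc, ← ENNReal.ofReal_add (by positivity) (by positivity)]
          congr 2; ring
  have hsub : {x | ENNReal.ofReal t < Iop (fun y => ENNReal.ofReal (g y)) x} ⊆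
      {x | ENNReal.ofReal (t / 2) ≤ ∫⁻ y, kN r (x - y) * H y} := by
    intro x hx
    by_contra hcon
    have hcon : ∫⁻ y, kN r (x - y) * H y < ENNReal.ofReal (t / 2) := not_le.1 hcon
    have h1 : ENNReal.ofReal t < _ := lt_of_lt_of_le hx (hpt x)
    have h2 : ENNReal.ofReal (t/2) + ∫⁻ y, kN r (x - y) * H y ≤ ENNReal.ofReal (t/2) + ENNReal.ofReal (t / 2) := by
      gcongr
    rw [← ENNReal.ofReal_add (by positivity) (by positivity), add_halves] at h2
    exact absurd (lt_of_lt_of_le h1 h2) (lt_irrefl _)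
  have hprod : Measurable (fun p : E5 × E5 => kN r (p.1 - p.2) * H p.2) := hkm.mul (hHm.comp measurable_snd)
  have hmk : ∫⁻ x, ∫⁻ y, kN r (x - y) * H y = ENNReal.ofReal (B * r) * ∫⁻ y, H y := by
    rw [lintegral_lintegral_swap hprod.aemeasurable]
    have : ∀ y, ∫⁻ x, kN r (x - y) * H y = ENNReal.ofReal (B * r) * H y := by
      intro y
      have e1 : Measurable (fun x => kN r (x - y)) :=
        (kN_meas r).comp (measurable_id.sub measurable_const)
      rw [lintegral_mul_const _ e1,
        lintegral_sub_right_eq_self (fun x => kN r x) y, hnear r hr0]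
    simp_rw [this]
    rw [lintegral_const_mul _ hHm]
  calc _ ≤ volume {x | ENNReal.ofReal (t / 2) ≤ ∫⁻ y, kN r (x - y) * H y} := measure_mono hsub
    _ ≤ (∫⁻ x, ∫⁻ y, kN r (x - y) * H y) / ENNReal.ofReal (t / 2) :=
        meas_ge_le_lintegral_div hprod.lintegral_prod_right'.aemeasurable (by simpa using ht) ENNReal.ofReal_ne_top
    _ = _ := by
        rw [hmk, mul_comm, mul_div_assoc, ← ENNReal.ofReal_div_of_pos (by positivity), mul_comm]
        congr 2
        rw [hr]
        field_simp
        norm_num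

/-- Hardy–Littlewood–Sobolev, normalised. -/
lemma hls : ∃ M : ℝ, 0 < M ∧ ∀ g : E5 → ℝ, Measurable g → (∀ y, 0 ≤ g y) →
    ∫⁻ y, ENNReal.ofReal (g y) ^ ((10:ℝ)/3) ≤ 1 → ∀ u : E5 → ℝ, Measurable u → (∀ x, 0 ≤ u x) →
    (∀ x, ENNReal.ofReal (u x) ≤ Iop (fun y => ENNReal.ofReal (g y)) x) →
    ∫⁻ x, ENNReal.ofReal (u x ^ (10:ℝ)) ≤ ENNReal.ofReal M := by
  obtain ⟨c, D, hc, hD, h⟩ := level_le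
  refine ⟨10 * (D * (c⁻¹) ^ ((7:ℝ)/3)), by positivity, fun g hg hg0 hg1 u hu hu0 hle => ?_⟩
  rw [lintegral_rpow_eq_lintegral_meas_lt_mul volume (Filter.Eventually.of_forall hu0) hu.aemeasurable
    (by norm_num), ENNReal.ofReal_mul (by norm_num : (0:ℝ) ≤ 10)]
  gcongr
  set F : ℝ → E5 → ENNReal := fun t y => ENNReal.ofReal (D * t ^ 6) *
      Set.indicator {p : ℝ × E5 | c * p.1 ^ 3 < g p.2} (fun p => ENNReal.ofReal (g p.2)) (t, y) with hF
  have hFm : Measurable (Function.uncurry F) := by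
    refine Measurable.mul (f := fun p : ℝ × E5 => ENNReal.ofReal (D * p.1 ^ 6)) (by fun_prop) ?_
    refine Measurable.indicator (by fun_prop) ?_
    exact measurableSet_lt (by fun_prop) (by fun_prop)
  calc _ ≤ ∫⁻ t in Set.Ioi (0:ℝ), ∫⁻ y, F t y := by
        refine setLIntegral_mono' measurableSet_Ioi fun t ht => ?_
        have ht : 0 < t := ht
        have h1 : volume {a | t < u a} ≤ _ := (measure_mono (fun a (ha : t < u a) =>
          lt_of_lt_of_le ((ENNReal.ofReal_lt_ofReal_iff (ht.trans ha)).2 ha) (hle a))).trans (h g hg hg1 t ht)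
        refine (mul_le_mul_left h1 _).trans (le_of_eq ?_)
        rw [hF]
        dsimp only
        rw [lintegral_const_mul, mul_comm, ← mul_assoc, ← ENNReal.ofReal_mul (by positivity)]
        · congr 2
          have : t ^ ((10:ℝ) - 1) = t ^ 9 := by
            rw [← Real.rpow_natCast]; norm_num
          rw [this]
          field_simp
        · have e1 : Measurable (Set.indicator {p : ℝ × E5 | c * p.1 ^ 3 < g p.2}
              (fun p => ENNReal.ofReal (g p.2))) := by
            refine Measurable.indicator (by fun_prop) ?_
            exact measurableSet_lt (by fun_prop) (by fun_prop)
          exact e1.comp (measurable_const.prodMk measurable_id)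
    _ = ∫⁻ y, ∫⁻ t in Set.Ioi (0:ℝ), F t y := lintegral_lintegral_swap hFm.aemeasurable
    _ ≤ ∫⁻ y, ENNReal.ofReal (D * (c⁻¹) ^ ((7:ℝ)/3)) * ENNReal.ofReal (g y) ^ ((10:ℝ)/3) := by
        refine lintegral_mono fun y => ?_
        dsimp only
        set T : ℝ := (c⁻¹ * g y) ^ ((1:ℝ)/3) with hT
        have hgy := hg0 y
        have hcg : 0 ≤ c⁻¹ * g y := by positivity
        have hT0 : 0 ≤ T := by positivity
        have hT3 : T ^ 3 = c⁻¹ * g y := by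
          rw [hT, ← Real.rpow_natCast, ← Real.rpow_mul hcg]; norm_num
        calc ∫⁻ t in Set.Ioi (0:ℝ), F t y
            ≤ ∫⁻ t in Set.Ioi (0:ℝ), Set.indicator (Set.Ioo 0 T)
                (fun _ => ENNReal.ofReal (D * T ^ 6) * ENNReal.ofReal (g y)) t := by
              refine setLIntegral_mono' measurableSet_Ioi fun t ht => ?_
              have ht : 0 < t := ht
              by_cases hh : c * t ^ 3 < g y
              · have htT : t < T := by
                  refine lt_of_pow_lt_pow_left₀ 3 hT0 ?_
                  rw [hT3, inv_mul_eq_div, lt_div_iff₀ hc, mul_comm]; exact hh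
                rw [Set.indicator_of_mem (show t ∈ Set.Ioo 0 T from ⟨ht, htT⟩)]
                simp only [hF]
                rw [Set.indicator_of_mem (show (t, y) ∈ {p : ℝ × E5 | c * p.1 ^ 3 < g p.2} from hh)]
                gcongr
              · simp only [hF]
                rw [Set.indicator_of_notMem (show (t, y) ∉ {p : ℝ × E5 | c * p.1 ^ 3 < g p.2} from hh)]
                simp
          _ ≤ ∫⁻ t, Set.indicator (Set.Ioo 0 T)
                (fun _ => ENNReal.ofReal (D * T ^ 6) * ENNReal.ofReal (g y)) t := setLIntegral_le_lintegral _ _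
          _ = ENNReal.ofReal (D * T ^ 6) * ENNReal.ofReal (g y) * ENNReal.ofReal T := by
              rw [lintegral_indicator_const measurableSet_Ioo, Real.volume_Ioo, sub_zero]
          _ = _ := by
              rw [ENNReal.ofReal_rpow_of_nonneg hgy (by norm_num), ← ENNReal.ofReal_mul (by positivity),
                ← ENNReal.ofReal_mul (by positivity), ← ENNReal.ofReal_mul (by positivity)]
              congr 1
              have h7 : T ^ 7 = (c⁻¹) ^ ((7:ℝ)/3) * g y ^ ((7:ℝ)/3) := by
                rw [hT, ← Real.rpow_natCast, ← Real.rpow_mul hcg, ← Real.mul_rpow (by positivity) hgy]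
                norm_num
              have h10 : g y ^ ((10:ℝ)/3) = g y ^ ((7:ℝ)/3) * g y := by
                rw [← Real.rpow_add_one' hgy (by norm_num)]; norm_num
              rw [h10]
              linear_combination D * g y * h7
    _ ≤ _ := by
        rw [lintegral_const_mul _ (by fun_prop)]
        exact mul_le_of_le_one_right' hg1

lemma Kker_meas : Measurable Kker := by
  unfold Kker
  fun_prop

lemma Kker_le (x : E5) : |Kker x| ≤ (‖x‖ ^ 4)⁻¹ := by
  unfold Kker
  rcases eq_or_ne x 0 with rfl | hx
  · simp
  have hn : 0 < ‖x‖ := norm_pos_iff.2 hx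
  have h4 : |x 4| ≤ ‖x‖ := by simpa using PiLp.norm_apply_le x 4
  have hpi : (3:ℝ) ≤ 8 * Real.pi ^ 2 := by nlinarith [Real.pi_gt_three]
  rw [abs_div, abs_mul, abs_of_pos (by positivity : 0 < 8 * Real.pi ^ 2 * ‖x‖ ^ 5), div_le_iff₀ (by positivity)]
  have : (‖x‖ ^ 4)⁻¹ * (8 * Real.pi ^ 2 * ‖x‖ ^ 5) = 8 * Real.pi ^ 2 * ‖x‖ := by
    field_simp
  rw [this, abs_of_pos (by norm_num : (0:ℝ) < 3)]
  gcongr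

lemma conv_meas (h : E5 → ℝ) (hh : Measurable h) :
    Measurable (fun x : E5 => ∫ y : E5, Kker (x - y) * h y) := by
  have : StronglyMeasurable (fun p : E5 × E5 => Kker (p.1 - p.2) * h p.2) :=
    ((Kker_meas.comp (measurable_fst.sub measurable_snd)).mul (hh.comp measurable_snd)).stronglyMeasurable
  exact this.integral_prod_right'.measurable

lemma conv_bound : ∃ M : ℝ, 0 < M ∧ ∀ f : E5 → ℝ, Measurable f → ∀ m : ℝ, 0 < m →
    eLpNorm f ((10/3 : NNReal) : ENNReal) volume ≤ ENNReal.ofReal m →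
    (∫ X : E5, |∫ Y : E5, Kker (X - Y) * f Y| ^ (10:ℕ)) ^ ((1:ℝ)/10) ≤ M * m := by
  obtain ⟨M, hM, H⟩ := hls
  refine ⟨M ^ ((1:ℝ)/10), by positivity, fun f hf m hm hfm => ?_⟩
  set h : E5 → ℝ := fun y => f y / m with hh
  have hhm : Measurable h := hf.div_const m
  have hfh : ∀ X, |∫ Y : E5, Kker (X - Y) * f Y| = m * |∫ Y : E5, Kker (X - Y) * h Y| := by
    intro X
    conv_rhs => rw [← abs_of_pos hm, ← abs_mul, ← integral_const_mul]
    congr 2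
    ext Y
    simp only [hh]
    field_simp
  have h1 : ∫⁻ y, ENNReal.ofReal (|h y|) ^ ((10:ℝ)/3) ≤ 1 := by
    have e0 : eLpNorm h ((10/3 : NNReal) : ENNReal) volume ≤ 1 := by
      have e1 : h = m⁻¹ • f := by
        ext y; simp [hh, div_eq_inv_mul]
      rw [e1, eLpNorm_const_smul, Real.enorm_eq_ofReal (by positivity)]
      calc _ ≤ ENNReal.ofReal m⁻¹ * ENNReal.ofReal m := by gcongr
        _ = 1 := by rw [← ENNReal.ofReal_mul (by positivity), inv_mul_cancel₀ hm.ne', ENNReal.ofReal_one]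
    have e : (((10/3 : NNReal) : ENNReal)).toReal = (10:ℝ)/3 := by simp
    rw [eLpNorm_eq_lintegral_rpow_enorm_toReal (by norm_num) ENNReal.coe_ne_top, e] at e0
    simp_rw [Real.enorm_eq_ofReal_abs] at e0
    by_contra hcon
    exact absurd e0 (not_le.2 (ENNReal.one_lt_rpow (not_le.1 hcon) (by norm_num)))
  have h2 := H (fun y => |h y|) hhm.abs (fun _ => abs_nonneg _) h1
    (fun X => |∫ Y : E5, Kker (X - Y) * h Y|) (conv_meas h hhm).abs (fun _ => abs_nonneg _) (by
      intro X
      rw [← Real.enorm_eq_ofReal_abs]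
      refine (enorm_integral_le_lintegral_enorm _).trans (lintegral_mono fun Y => ?_)
      dsimp only
      rw [Real.enorm_eq_ofReal_abs, abs_mul, ENNReal.ofReal_mul (abs_nonneg _)]
      gcongr
      exact Kker_le _)
  have h3 : ∫ X : E5, |∫ Y : E5, Kker (X - Y) * h Y| ^ (10:ℕ) ≤ M := by
    rw [integral_eq_lintegral_of_nonneg_ae (Filter.Eventually.of_forall fun _ => by positivity)
      ((conv_meas h hhm).abs.pow_const 10).aestronglyMeasurable]
    refine ENNReal.toReal_le_of_le_ofReal hM.le (le_trans (le_of_eq ?_) h2)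
    congr 1; ext X; congr 1
    rw [← Real.rpow_natCast]; norm_num
  have h4 : 0 ≤ ∫ X : E5, |∫ Y : E5, Kker (X - Y) * h Y| ^ (10:ℕ) := integral_nonneg fun _ => by positivity
  simp_rw [hfh, mul_pow]
  rw [integral_const_mul, Real.mul_rpow (by positivity) h4, mul_comm]
  gcongr
  rw [← Real.rpow_natCast, ← Real.rpow_mul hm.le]
  norm_num

/-- Fixed-time core estimate: for `f ∈ C_c^∞(ℝ⁵)` supported
in the ball of radius `2`, `‖K * f‖_{L¹⁰(ℝ⁵)} ≤ C(‖f‖_{L²} + ‖∇f‖_{L²})`. -/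
theorem statement_18 :
    ∃ C : ℝ, ∀ f : E5 → ℝ,
      ContDiff ℝ (⊤ : ℕ∞) f → HasCompactSupport f →
      (∀ Y : E5, f Y ≠ 0 → ‖Y‖ ≤ 2) →
      (∫ X : E5, |∫ Y : E5, Kker (X - Y) * f Y| ^ (10:ℕ)) ^ ((1:ℝ)/10)
        ≤ C * ((∫ Y : E5, (f Y) ^ 2) ^ ((1:ℝ)/2)
            + (∫ Y : E5, ‖fderiv ℝ f Y‖ ^ 2) ^ ((1:ℝ)/2)) := by
  obtain ⟨M, hM, H⟩ := conv_bound
  set S : NNReal := SNormLESNormFDerivOfEqConst ℝ (volume : Measure E5) ((2 : NNReal) : ℝ) with hS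
  refine ⟨M * S, fun f hf hfc _ => ?_⟩
  set P := (∫ Y : E5, ‖fderiv ℝ f Y‖ ^ 2) ^ ((1:ℝ)/2) with hP
  set Q := (∫ Y : E5, (f Y) ^ 2) ^ ((1:ℝ)/2) with hQ
  have hP0 : 0 ≤ P := Real.rpow_nonneg (integral_nonneg fun _ => by positivity) _
  have hQ0 : 0 ≤ Q := Real.rpow_nonneg (integral_nonneg fun _ => by positivity) _
  have hf1 : ContDiff ℝ 1 f := hf.of_le (by exact_mod_cast le_top)
  have hsob := eLpNorm_le_eLpNorm_fderiv_of_eq (volume : Measure E5) hf1 hfc (p := 2) (p' := 10/3)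
    (by norm_num) (by simp) (by simp; norm_num)
  have hcont : Continuous (fderiv ℝ f) := hf1.continuous_fderiv one_ne_zero
  have hmem : MemLp (fderiv ℝ f) 2 (volume : Measure E5) :=
    hcont.memLp_of_hasCompactSupport (hfc.fderiv ℝ)
  have hPe : eLpNorm (fderiv ℝ f) ((2 : NNReal) : ENNReal) volume = ENNReal.ofReal P := by
    have := hmem.eLpNorm_eq_integral_rpow_norm (by norm_num) (by norm_num)
    simp only [ENNReal.coe_ofNat]
    rw [this, hP]
    simp
  rw [hPe, ← hS] at hsob
  have key : ∀ ε : ℝ, 0 < ε → (∫ X : E5, |∫ Y : E5, Kker (X - Y) * f Y| ^ (10:ℕ)) ^ ((1:ℝ)/10)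
      ≤ M * (S * P) + ε := by
    intro ε hε
    have := H f hf.continuous.measurable (S * P + ε / M) (by positivity) (hsob.trans (by
      rw [ENNReal.ofReal_add (by positivity) (by positivity), ENNReal.ofReal_mul (by positivity),
        ENNReal.ofReal_coe_nnreal]
      exact le_self_add))
    refine this.trans (le_of_eq ?_)
    field_simp
  refine (le_of_forall_pos_le_add key).trans ?_
  rw [mul_assoc]
  gcongr
  linarith

end
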